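/- arXiv:1902.02608 — 2 statements merged into one kernel-verified Lean document; each statement's English description precedes it below -/
import Mathlib

section
/- Let B_{n,n} be the n-barbell graph. Then the spectrum of its eccentricity matrix is {0 with multiplicity 2(n−2), and ±(3(n−1) ± √(9n² − 2n − 7))/2 each with multiplicity 1}. -/
open Matrix

/-- The eccentricity of a vertex: the largest distance from it to any vertex. -/
noncomputable def SimpleGraph.ecc {V : Type*} [Fintype V] (G : SimpleGraph V) (v : V) : ℕ :=
  Finset.univ.sup (G.dist v)

/-- The eccentricity matrix of a graph: `ε(G)_{uw} = d(u,w)` if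
`d(u,w) = min{e(u), e(w)}`, and `0` otherwise. -/
noncomputable def SimpleGraph.eccMatrix {V : Type*} [Fintype V] (G : SimpleGraph V) :
    Matrix V V ℝ :=
  Matrix.of fun u w =>
    if G.dist u w = min (G.ecc u) (G.ecc w) then (G.dist u w : ℝ) else 0

open Polynomial

/-- The `n`-barbell graph: two copies of `Kₙ` joined by a bridge. -/
def barbell (n : ℕ) : SimpleGraph (Fin n ⊕ Fin n) :=
  SimpleGraph.fromRel fun x y =>
    (∃ i j : Fin n, x = Sum.inl i ∧ y = Sum.inl j) ∨
    (∃ i j : Fin n, x = Sum.inr i ∧ y = Sum.inr j) ∨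
    (∃ i j : Fin n, x = Sum.inl i ∧ y = Sum.inr j ∧ (i : ℕ) = 0 ∧ (j : ℕ) = 0)

/-- A function `D` that vanishes on the diagonal, drops by at most one along every edge, and
drops by exactly one along some edge wherever it is positive, is the graph distance. -/
theorem SimpleGraph.dist_eq_of_descent {V : Type*} (G : SimpleGraph V) (D : V → V → ℕ)
    (h_diag : ∀ u, D u u = 0) (h_lip : ∀ u w v, G.Adj u w → D u v ≤ D w v + 1)
    (h_desc : ∀ u v, u ≠ v → ∃ w, G.Adj u w ∧ D u v = D w v + 1) (u v : V) :
    G.dist u v = D u v := by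
  have lower : ∀ {u v : V} (p : G.Walk u v), D u v ≤ p.length := by
    intro u v p
    induction p with
    | nil => simp [h_diag]
    | cons h p ih => exact (h_lip _ _ _ h).trans (by simpa using ih)
  have upper : ∀ (k : ℕ) (u : V), D u v = k → ∃ p : G.Walk u v, p.length = k := by
    intro k
    induction k with
    | zero =>
      intro u hu
      rcases eq_or_ne u v with rfl | huv
      · exact ⟨.nil, rfl⟩
      · obtain ⟨w, -, hw⟩ := h_desc u v huv
        omega
    | succ k ih =>
      intro u hu
      rcases eq_or_ne u v with rfl | huv
      · simp [h_diag] at hu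
      · obtain ⟨w, hadj, hw⟩ := h_desc u v huv
        obtain ⟨p, hp⟩ := ih w (by omega)
        exact ⟨.cons hadj p, by simp [hp]⟩
  obtain ⟨p, hp⟩ := upper _ u rfl
  obtain ⟨q, hq⟩ := p.reachable.exists_walk_length_eq_dist
  exact le_antisymm (hp ▸ SimpleGraph.dist_le p) (hq ▸ lower q)

/-- The distance of a vertex of `Kₙ` from the end of the bridge. -/
def bridgeDepth {n : ℕ} (i : Fin n) : ℕ := if (i : ℕ) = 0 then 0 else 1

/-- The distance function of the barbell graph. -/
def barbellDist {n : ℕ} : Fin n ⊕ Fin n → Fin n ⊕ Fin n → ℕ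
  | .inl i, .inl j => if i = j then 0 else 1
  | .inr i, .inr j => if i = j then 0 else 1
  | .inl i, .inr j => bridgeDepth i + bridgeDepth j + 1
  | .inr i, .inl j => bridgeDepth i + bridgeDepth j + 1

@[simp] theorem barbell_adj_inl_inl {n : ℕ} (i j : Fin n) :
    (barbell n).Adj (.inl i) (.inl j) ↔ i ≠ j := by
  simp [barbell]

@[simp] theorem barbell_adj_inr_inr {n : ℕ} (i j : Fin n) :
    (barbell n).Adj (.inr i) (.inr j) ↔ i ≠ j := by
  simp [barbell]

@[simp] theorem barbell_adj_inl_inr {n : ℕ} (i j : Fin n) :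
    (barbell n).Adj (.inl i) (.inr j) ↔ (i : ℕ) = 0 ∧ (j : ℕ) = 0 := by
  simp [barbell]

@[simp] theorem barbell_adj_inr_inl {n : ℕ} (i j : Fin n) :
    (barbell n).Adj (.inr i) (.inl j) ↔ (i : ℕ) = 0 ∧ (j : ℕ) = 0 := by
  simp [barbell, and_comm]

theorem barbell_dist {n : ℕ} (u v : Fin n ⊕ Fin n) :
    (barbell n).dist u v = barbellDist u v := by
  refine (barbell n).dist_eq_of_descent barbellDist ?_ ?_ ?_ u v
  · rintro (i | i) <;> simp [barbellDist]
  · rintro (i | i) (j | j) (k | k) h <;>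
      simp only [barbell_adj_inl_inl, barbell_adj_inr_inr, barbell_adj_inl_inr,
        barbell_adj_inr_inl] at h <;>
      simp only [barbellDist, bridgeDepth] <;> grind
  · have h_zero (i : Fin n) : ∃ z : Fin n, (z : ℕ) = 0 := ⟨⟨0, i.pos⟩, rfl⟩
    rintro (i | i) (j | j) h
    · exact ⟨.inl j, by simpa using h, by simpa [barbellDist] using h⟩
    · obtain ⟨z, hz⟩ := h_zero i
      by_cases hi : (i : ℕ) = 0
      · refine ⟨.inr z, by simp [hi, hz], ?_⟩
        simp only [barbellDist, bridgeDepth]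
        grind
      · refine ⟨.inl z, by rw [barbell_adj_inl_inl]; grind, ?_⟩
        simp [barbellDist, bridgeDepth, hi, hz, add_comm]
    · obtain ⟨z, hz⟩ := h_zero i
      by_cases hi : (i : ℕ) = 0
      · refine ⟨.inl z, by simp [hi, hz], ?_⟩
        simp only [barbellDist, bridgeDepth]
        grind
      · refine ⟨.inr z, by rw [barbell_adj_inr_inr]; grind, ?_⟩
        simp [barbellDist, bridgeDepth, hi, hz, add_comm]
    · exact ⟨.inr j, by simpa using h, by simpa [barbellDist] using h⟩

theorem barbell_ecc {n : ℕ} (hn : 2 ≤ n) (u : Fin n ⊕ Fin n) :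
    (barbell n).ecc u = bridgeDepth (u.elim id id) + 2 := by
  let w : Fin n := ⟨1, hn⟩
  have hw : bridgeDepth w = 1 := rfl
  have hle (i : Fin n) : bridgeDepth i ≤ 1 := by
    unfold bridgeDepth
    split <;> omega
  refine le_antisymm (Finset.sup_le fun v _ => ?_) ?_
  · rw [barbell_dist]
    rcases u with i | i <;> rcases v with j | j <;>
      simp only [barbellDist, Sum.elim_inl, Sum.elim_inr, id] <;>
      have := hle j <;> grind
  · rcases u with i | i
    · refine le_trans ?_ (Finset.le_sup (Finset.mem_univ (Sum.inr w)))
      simp [barbell_dist, barbellDist, hw]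
    · refine le_trans ?_ (Finset.le_sup (Finset.mem_univ (Sum.inl w)))
      simp [barbell_dist, barbellDist, hw]

/-- The off-diagonal block of the eccentricity matrix of the barbell graph. -/
def barbellBlock (n : ℕ) : Matrix (Fin n) (Fin n) ℝ :=
  Matrix.of fun i j =>
    if (i : ℕ) = 0 then (if (j : ℕ) = 0 then 0 else 2) else (if (j : ℕ) = 0 then 2 else 3)

theorem eccMatrix_barbell {n : ℕ} (hn : 2 ≤ n) :
    (barbell n).eccMatrix = fromBlocks 0 (barbellBlock n) (barbellBlock n) 0 := by
  ext (i | i) (j | j) <;>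
    simp only [SimpleGraph.eccMatrix, barbell_dist, barbell_ecc hn, barbellDist, bridgeDepth,
      barbellBlock, of_apply, fromBlocks_apply₁₁, fromBlocks_apply₁₂, fromBlocks_apply₂₁,
      fromBlocks_apply₂₂, Sum.elim_inl, Sum.elim_inr, id, Matrix.zero_apply] <;>
    split_ifs <;> norm_num <;> grind

theorem charpoly_fromBlocks_zero_self {m R : Type*} [Fintype m] [DecidableEq m] [CommRing R]
    (A : Matrix m m R) :
    (fromBlocks 0 A A 0).charpoly = A.charpoly * (-A).charpoly := by
  let P : (Matrix (m ⊕ m) (m ⊕ m) R)ˣ :=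
    ⟨fromBlocks 1 1 0 1, fromBlocks 1 (-1) 0 1,
      by simp [fromBlocks_multiply, fromBlocks_one], by simp [fromBlocks_multiply, fromBlocks_one]⟩
  have h : P.val * fromBlocks 0 A A 0 * P⁻¹.val = fromBlocks A 0 A (-A) := by
    simp [P, fromBlocks_multiply, Units.inv_mk]
  rw [← charpoly_fromBlocks_zero₁₂ (M₂₁ := A), ← h, coe_units_inv, charpoly_units_conj]

theorem charpoly_smul_barbellBlock {n : ℕ} (hn : 2 ≤ n) (c : ℝ) :
    (c • barbellBlock n).charpoly =
      X ^ (n - 2) * (X ^ 2 - C (3 * c * ((n : ℝ) - 1)) * X - C (4 * c ^ 2 * ((n : ℝ) - 1))) := by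
  obtain ⟨m, rfl⟩ := Nat.exists_eq_add_of_le' hn
  let U : Matrix (Fin (m + 2)) (Fin 2) ℝ :=
    Matrix.of fun i => if (i : ℕ) = 0 then ![2, 0] else ![0, 1]
  let W : Matrix (Fin 2) (Fin (m + 2)) ℝ :=
    Matrix.of ![fun j => if (j : ℕ) = 0 then 0 else c,
      fun j => if (j : ℕ) = 0 then 2 * c else 3 * c]
  have h_mul : c • barbellBlock (m + 2) = U * W := by
    ext i j
    simp only [barbellBlock, Matrix.smul_apply, of_apply, mul_apply, Fin.sum_univ_two, U, W, smul_eq_mul]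
    split_ifs <;> simp <;> grind
  have h_comm : W * U = !![0, c * (m + 1); 4 * c, 3 * c * (m + 1)] := by
    ext i j
    fin_cases i <;> fin_cases j <;>
      simp [U, W, mul_apply, Fin.sum_univ_succ (n := m + 1)] <;> ring
  rw [h_mul, charpoly_mul_comm_of_le _ _ (by simp), h_comm, charpoly_fin_two]
  simp only [trace_fin_two_of, det_fin_two_of, Fintype.card_fin]
  have h_det : 0 * (3 * c * ((m : ℝ) + 1)) - c * (m + 1) * (4 * c) = -(4 * c ^ 2 * (m + 1)) := by
    ring
  have h_cast : ((m + 2 : ℕ) : ℝ) - 1 = m + 1 := by push_cast; ring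
  rw [h_det, h_cast, zero_add, C_neg, sub_eq_add_neg _ (C (4 * c ^ 2 * _))]

/-- The spectrum of the eccentricity matrix of the `n`-barbell graph consists of `0` with
multiplicity `2(n-2)` and `±(3(n-1) ± √(9n² - 2n - 7))/2`, each with multiplicity `1`. -/
theorem eccMatrix_barbell_spectrum (n : ℕ) (hn : 2 ≤ n) :
    (barbell n).eccMatrix.charpoly =
      X ^ (2 * (n - 2)) *
        (X - C ((3 * ((n : ℝ) - 1) + Real.sqrt (9 * (n : ℝ) ^ 2 - 2 * n - 7)) / 2)) *
        (X - C ((3 * ((n : ℝ) - 1) - Real.sqrt (9 * (n : ℝ) ^ 2 - 2 * n - 7)) / 2)) *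
        (X + C ((3 * ((n : ℝ) - 1) + Real.sqrt (9 * (n : ℝ) ^ 2 - 2 * n - 7)) / 2)) *
        (X + C ((3 * ((n : ℝ) - 1) - Real.sqrt (9 * (n : ℝ) ^ 2 - 2 * n - 7)) / 2)) := by
  have hn' : (2 : ℝ) ≤ n := by exact_mod_cast hn
  set s := Real.sqrt (9 * (n : ℝ) ^ 2 - 2 * n - 7)
  have hs2 : s ^ 2 = 9 * (n : ℝ) ^ 2 - 2 * n - 7 := Real.sq_sqrt (by nlinarith)
  set a := (3 * ((n : ℝ) - 1) + s) / 2 with ha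
  set b := (3 * ((n : ℝ) - 1) - s) / 2 with hb
  have h_sum : 3 * ((n : ℝ) - 1) = a + b := by rw [ha, hb]; ring
  have h_prod : 4 * ((n : ℝ) - 1) = -(a * b) := by rw [ha, hb]; linarith
  have h_pos := charpoly_smul_barbellBlock hn 1
  have h_neg := charpoly_smul_barbellBlock hn (-1)
  rw [one_smul, mul_one, one_pow, mul_one, h_sum, h_prod] at h_pos
  rw [neg_one_smul, neg_one_sq, mul_one, mul_neg_one, neg_mul, h_sum, h_prod] at h_neg
  rw [eccMatrix_barbell hn, charpoly_fromBlocks_zero_self, h_pos, h_neg]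
  simp only [C_add, C_neg, C_mul]
  ring
end

section
/- Let P_n be the path on n ≥ 4 vertices. Then the inertia of its eccentricity matrix ε(P_n) is (2, 2, n−4): exactly two positive eigenvalues, two negative eigenvalues, and 0 with multiplicity n−4. In particular, rank(ε(P_n)) = 4. -/
open Matrix

open Polynomial

namespace SimpleGraph

lemma pathGraph_dist_le {n : ℕ} (k : ℕ) (u v : Fin n) (h : (v : ℕ) = u + k) :
    (pathGraph n).dist u v ≤ k := by
  obtain ⟨m, rfl⟩ : ∃ m, n = m + 1 := ⟨n - 1, by have := u.2; omega⟩
  induction k generalizing v with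
  | zero =>
    obtain rfl : v = u := Fin.ext h
    simp
  | succ k ih =>
    have hk : (u : ℕ) + k < m + 1 := by have := v.2; omega
    have h₁ := ih ⟨u + k, hk⟩ rfl
    have h₂ : (pathGraph (m + 1)).Adj ⟨u + k, hk⟩ v := by
      rw [pathGraph_adj]; left; simp only; omega
    have h₃ := (pathGraph_connected m).dist_triangle (u := u) (v := ⟨u + k, hk⟩) (w := v)
    rw [dist_eq_one_iff_adj.mpr h₂] at h₃
    omega

lemma pathGraph_le_walk_length {n : ℕ} {u v : Fin n} (p : (pathGraph n).Walk u v) :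
    Nat.dist u v ≤ p.length := by
  induction p with
  | nil => simp [Nat.dist]
  | cons h p ih =>
    rw [pathGraph_adj] at h
    simp only [Nat.dist, Walk.length_cons] at *
    omega

lemma pathGraph_dist {n : ℕ} (u v : Fin n) : (pathGraph n).dist u v = Nat.dist u v := by
  apply le_antisymm
  · rcases le_total u v with h | h
    · exact pathGraph_dist_le _ u v (by simp only [Nat.dist, Fin.le_def] at *; omega)
    · rw [dist_comm]
      exact pathGraph_dist_le _ v u (by simp only [Nat.dist, Fin.le_def] at *; omega)
  · obtain ⟨m, rfl⟩ : ∃ m, n = m + 1 := ⟨n - 1, by have := u.2; omega⟩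
    obtain ⟨p, hp⟩ := (pathGraph_connected m).exists_walk_length_eq_dist u v
    exact hp ▸ pathGraph_le_walk_length p

lemma pathGraph_ecc {n : ℕ} (u : Fin n) : (pathGraph n).ecc u = max (u : ℕ) (n - 1 - u) := by
  have hu := u.2
  apply le_antisymm
  · refine Finset.sup_le fun v _ => ?_
    rw [pathGraph_dist]
    simp only [Nat.dist]
    omega
  · refine max_le ?_ ?_
    · refine le_trans ?_ (Finset.le_sup (f := (pathGraph n).dist u)
        (Finset.mem_univ ⟨0, by omega⟩))
      rw [pathGraph_dist]
      simp [Nat.dist]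
    · refine le_trans ?_ (Finset.le_sup (f := (pathGraph n).dist u)
        (Finset.mem_univ ⟨n - 1, by omega⟩))
      rw [pathGraph_dist]
      simp [Nat.dist]

end SimpleGraph

/-- The first row of the eccentricity matrix of the path on `d + 1` vertices, with its last entry
halved, so that the matrix splits symmetrically between the two end vertices. -/
noncomputable def pathFarVec (d : ℕ) (i : Fin (d + 1)) : ℝ :=
  if (i : ℕ) = d then d / 2 else if d ≤ 2 * i then (i : ℝ) else 0

lemma eccMatrix_path_apply {d : ℕ} (hd : 1 ≤ d) (u w : Fin (d + 1)) :
    (SimpleGraph.pathGraph (d + 1)).eccMatrix u w =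
      pathFarVec d u * Pi.single (M := fun _ => ℝ) 0 1 w
      + Pi.single (M := fun _ => ℝ) 0 1 u * pathFarVec d w
      + pathFarVec d u.rev * Pi.single (M := fun _ => ℝ) (Fin.last d) 1 w
      + Pi.single (M := fun _ => ℝ) (Fin.last d) 1 u * pathFarVec d w.rev := by
  have hu := u.2
  have hw := w.2
  have hur : (u.rev : ℕ) = d - u := by rw [Fin.val_rev]; omega
  have hwr : (w.rev : ℕ) = d - w := by rw [Fin.val_rev]; omega
  simp only [SimpleGraph.eccMatrix, Matrix.of_apply, SimpleGraph.pathGraph_dist,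
    SimpleGraph.pathGraph_ecc, pathFarVec, Pi.single_apply, hur, hwr, Fin.ext_iff, Fin.val_zero,
    Fin.val_last, add_tsub_cancel_right, Nat.dist]
  generalize (u : ℕ) = x at *
  generalize (w : ℕ) = y at *
  clear hur hwr u w
  have hu' : x ≤ d := by omega
  have hw' : y ≤ d := by omega
  clear hu hw
  have hd0 : d ≠ 0 := by omega
  rcases Nat.eq_zero_or_pos x with rfl | hx0 <;> rcases Nat.eq_zero_or_pos y with rfl | hy0 <;>
  [skip; rcases hw'.eq_or_lt with rfl | hyd; rcases hu'.eq_or_lt with rfl | hxd;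
    (rcases hu'.eq_or_lt with rfl | hxd <;> rcases hw'.eq_or_lt with h | hyd <;> try subst h)]
  all_goals simp [*, Nat.ne_of_gt, Nat.ne_of_lt, hd0.symm]
  all_goals first | omega | (split_ifs <;> first | omega | rfl)

lemma sum_pathFarVec_mul_add_sq (d : ℕ) (hd : 3 ≤ d) (ε : ℝ) (hε : ε ^ 2 = 1) :
    ((d : ℝ) / 2) ^ 2 < ∑ i, pathFarVec d i * pathFarVec d i
      + ε * ∑ i, pathFarVec d i * pathFarVec d i.rev := by
  have hε1 : 0 ≤ 1 + ε := by nlinarith [sq_nonneg (1 + ε)]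
  have hsum : ∑ i, pathFarVec d i * pathFarVec d i + ε * ∑ i, pathFarVec d i * pathFarVec d i.rev =
      ∑ i, (pathFarVec d i * pathFarVec d i + ε * (pathFarVec d i * pathFarVec d i.rev)) := by
    rw [Finset.sum_add_distrib, Finset.mul_sum]
  have hl : pathFarVec d (Fin.last d) = d / 2 := by simp [pathFarVec]
  have hl' : pathFarVec d (Fin.last d).rev = 0 := by
    rw [pathFarVec, Fin.val_rev, if_neg, if_neg] <;> simp only [Fin.val_last] <;> omega
  let j : Fin (d + 1) := ⟨d - 1, by omega⟩
  have hj : pathFarVec d j = d - 1 := by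
    simp only [pathFarVec, j]
    rw [if_neg (by omega), if_pos (by omega), Nat.cast_pred (by omega)]
  have hj' : pathFarVec d j.rev = 0 := by
    simp only [pathFarVec, Fin.val_rev, j]
    rw [if_neg (by omega), if_neg (by omega)]
  have hlj : Fin.last d ≠ j := by
    simp only [ne_eq, Fin.ext_iff, Fin.val_last, j]
    omega
  have hnonneg (i : Fin (d + 1)) :
      0 ≤ pathFarVec d i * pathFarVec d i + ε * (pathFarVec d i * pathFarVec d i.rev) := by
    by_cases hi : 2 * (i : ℕ) = d
    · have hir : i.rev = i := by rw [Fin.ext_iff, Fin.val_rev]; omega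
      rw [hir, ← one_add_mul]
      exact mul_nonneg hε1 (mul_self_nonneg _)
    · have h0 : pathFarVec d i * pathFarVec d i.rev = 0 := by
        have hi' := i.2
        rw [mul_eq_zero]
        rcases lt_or_gt_of_ne hi with h | h
        · left
          rw [pathFarVec, if_neg (by omega), if_neg (by omega)]
        · right
          rw [pathFarVec, Fin.val_rev, if_neg (by omega), if_neg (by omega)]
      rw [h0, mul_zero, add_zero]
      exact mul_self_nonneg _
  have hpair := Finset.sum_le_sum_of_subset_of_nonneg (Finset.subset_univ {Fin.last d, j})
    fun i _ _ => hnonneg i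
  rw [Finset.sum_pair hlj, hl, hl', hj, hj'] at hpair
  rw [hsum]
  have hd' : (3 : ℝ) ≤ d := by exact_mod_cast hd
  nlinarith

lemma charpoly_pathQuotient (c a b : ℝ) :
    (!![0, 1, c, 0; a, 0, b, c; c, 0, 0, 1; b, c, a, 0] : Matrix (Fin 4) (Fin 4) ℝ).charpoly =
      ((X - C c) ^ 2 - C (a + b)) * ((X + C c) ^ 2 - C (a - b)) := by
  simp [Matrix.charpoly, Matrix.charmatrix, Matrix.det_succ_row_zero, Fin.sum_univ_succ,
    Fin.succAbove]
  ring

lemma charpoly_eccMatrix_path {d : ℕ} (hd : 3 ≤ d) :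
    (SimpleGraph.pathGraph (d + 1)).eccMatrix.charpoly = X ^ (d + 1 - 4) *
      (((X - C ((d : ℝ) / 2)) ^ 2 - C (∑ i, pathFarVec d i * pathFarVec d i
          + ∑ i, pathFarVec d i * pathFarVec d i.rev)) *
      ((X + C ((d : ℝ) / 2)) ^ 2 - C (∑ i, pathFarVec d i * pathFarVec d i
          - ∑ i, pathFarVec d i * pathFarVec d i.rev))) := by
  let U : Matrix (Fin (d + 1)) (Fin 4) ℝ := Matrix.of fun i =>
    ![pathFarVec d i, Pi.single (M := fun _ => ℝ) 0 1 i, pathFarVec d i.rev,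
      Pi.single (M := fun _ => ℝ) (Fin.last d) 1 i]
  let W : Matrix (Fin 4) (Fin (d + 1)) ℝ := Matrix.of
    ![Pi.single 0 1, pathFarVec d, Pi.single (Fin.last d) 1, fun i => pathFarVec d i.rev]
  have hUW : (SimpleGraph.pathGraph (d + 1)).eccMatrix = U * W := by
    ext u w
    rw [eccMatrix_path_apply (by omega)]
    simp [U, W, Matrix.mul_apply, Fin.sum_univ_four]
  have h0 : pathFarVec d 0 = 0 := by
    rw [pathFarVec, if_neg, if_neg] <;> simp only [Fin.val_zero] <;> omega
  have hl : pathFarVec d (Fin.last d) = d / 2 := by simp [pathFarVec]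
  have hrev : ∑ i, pathFarVec d (Fin.rev i) * pathFarVec d (Fin.rev i) =
      ∑ i, pathFarVec d i * pathFarVec d i :=
    Equiv.sum_comp Fin.revPerm fun i => pathFarVec d i * pathFarVec d i
  have hWU : W * U = !![0, 1, (d : ℝ) / 2, 0;
      ∑ i, pathFarVec d i * pathFarVec d i, 0, ∑ i, pathFarVec d i * pathFarVec d i.rev, d / 2;
      d / 2, 0, 0, 1;
      ∑ i, pathFarVec d i * pathFarVec d i.rev, d / 2, ∑ i, pathFarVec d i * pathFarVec d i, 0] := by
    have hd0 : (0 : Fin (d + 1)) ≠ Fin.last d := by simp [Fin.ext_iff]; omega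
    ext k l
    fin_cases k <;> fin_cases l <;>
      simp [U, W, Matrix.mul_apply, Pi.single_apply, h0, hl, hrev, hd0, mul_comm]
  rw [hUW, Matrix.charpoly_mul_comm_of_le _ _ (by simp; omega), hWU, charpoly_pathQuotient]
  simp

lemma Matrix.IsHermitian.rank_eq_card_filter_roots_charpoly {ι : Type*} [Fintype ι] [DecidableEq ι]
    {A : Matrix ι ι ℝ} (hA : A.IsHermitian) :
    A.rank = Multiset.card (A.charpoly.roots.filter fun x => x ≠ 0) := by
  rw [hA.rank_eq_card_non_zero_eigs, hA.roots_charpoly_eq_eigenvalues, Multiset.filter_map,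
    Multiset.card_map, Fintype.card_subtype]
  simp [Finset.card]

/-- The inertia of the eccentricity matrix of the path `Pₙ` (`n ≥ 4`) is `(2, 2, n - 4)`:
two positive eigenvalues, two negative eigenvalues, `0` with multiplicity `n - 4`; in
particular the rank of `ε(Pₙ)` is `4`. -/
theorem eccMatrix_path_inertia (n : ℕ) (hn : 4 ≤ n) :
    Multiset.card (((SimpleGraph.pathGraph n).eccMatrix.charpoly.roots.filter
        fun x => 0 < x)) = 2 ∧
    Multiset.card (((SimpleGraph.pathGraph n).eccMatrix.charpoly.roots.filter
        fun x => x < 0)) = 2 ∧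
    Multiset.count (0 : ℝ) (SimpleGraph.pathGraph n).eccMatrix.charpoly.roots = n - 4 ∧
    (SimpleGraph.pathGraph n).eccMatrix.rank = 4 := by
  obtain ⟨d, rfl⟩ : ∃ d, n = d + 1 := ⟨n - 1, by omega⟩
  have hd : 3 ≤ d := by omega
  have hA : (SimpleGraph.pathGraph (d + 1)).eccMatrix.IsHermitian := by
    ext u w
    simp [SimpleGraph.eccMatrix, SimpleGraph.dist_comm, min_comm]
  rw [hA.rank_eq_card_filter_roots_charpoly, charpoly_eccMatrix_path hd]
  have hs := sum_pathFarVec_mul_add_sq d hd 1 (by norm_num)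
  have ht := sum_pathFarVec_mul_add_sq d hd (-1) (by norm_num)
  rw [one_mul] at hs
  rw [neg_one_mul, ← sub_eq_add_neg] at ht
  set a := ∑ i, pathFarVec d i * pathFarVec d i
  set b := ∑ i, pathFarVec d i * pathFarVec d i.rev
  have hc : (0 : ℝ) ≤ (d : ℝ) / 2 := by positivity
  generalize (d : ℝ) / 2 = c at *
  have hs' := Real.lt_sqrt_of_sq_lt hs
  have ht' := Real.lt_sqrt_of_sq_lt ht
  have hss := Real.sq_sqrt ((sq_nonneg c).trans hs.le)
  have htt := Real.sq_sqrt ((sq_nonneg c).trans ht.le)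
  generalize √(a + b) = s at *
  generalize √(a - b) = t at *
  have hfac : ((X - C c) ^ 2 - C (a + b)) * ((X + C c) ^ 2 - C (a - b)) =
      (({c + s, -c + t, c - s, -c - t} : Multiset ℝ).map fun r => X - C r).prod := by
    rw [← hss, ← htt]
    simp
    ring
  have hroots : (X ^ (d + 1 - 4) * (((X - C c) ^ 2 - C (a + b)) *
      ((X + C c) ^ 2 - C (a - b)))).roots =
      (d + 1 - 4) • {0} + ({c + s, -c + t, c - s, -c - t} : Multiset ℝ) := by
    rw [hfac, roots_mul, roots_X_pow, roots_multiset_prod_X_sub_C]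
    exact mul_ne_zero (pow_ne_zero _ X_ne_zero)
      (monic_multiset_prod_of_monic _ _ fun r _ => monic_X_sub_C r).ne_zero
  rw [hroots, Multiset.nsmul_singleton]
  have h₁ : 0 < c + s := by linarith
  have h₂ : 0 < -c + t := by linarith
  have h₃ : c - s < 0 := by linarith
  have h₄ : -c - t < 0 := by linarith
  generalize c + s = p at *
  generalize -c + t = q at *
  generalize c - s = x at *
  generalize -c - t = y at *
  have h0 : (0 : ℝ) ∉ ({p, q, x, y} : Multiset ℝ) := by
    simp [h₁.ne, h₂.ne, h₃.ne', h₄.ne']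
  refine ⟨?_, ?_, ?_, ?_⟩
  · simp [Multiset.filter_add, Multiset.filter_singleton, h₁, h₂, h₃.le.not_gt, h₄.le.not_gt]
    exact fun a ha => (Multiset.eq_of_mem_replicate ha).le
  · simp [Multiset.filter_add, Multiset.filter_singleton, h₃, h₄, h₁.le.not_gt, h₂.le.not_gt]
    exact fun a ha => (Multiset.eq_of_mem_replicate ha).ge
  · rw [Multiset.count_add, Multiset.count_eq_zero_of_notMem h0]
    simp
  · simp [Multiset.filter_add, Multiset.filter_singleton, h₁.ne', h₂.ne', h₃.ne, h₄.ne]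
    exact fun a ha => Multiset.eq_of_mem_replicate ha
end
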